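/- Let p be an odd prime, r a non-negative integer, and q = p^{2r+1}. If A ⊆ F_q satisfies 2·p^r < |A| < sqrt(q), then the set (A-A)/(A-A) = { (a - b)/(c - e) : a, b, c, e ∈ A, c ≠ e } ⊆ F_q has size strictly greater than |A|^2 / 2. -/

import Mathlib

section RedeiPolynomial

open Polynomial Finset

/-- The total degree of a bivariate polynomial, written as a polynomial in `F[X][X]`, is at
most `d`. -/
def TotalDegreeLE {F : Type*} [Semiring F] (P : F[X][X]) (d : ℕ) : Prop :=
  ∀ i j, d < i + j → (P.coeff i).coeff j = 0

namespace TotalDegreeLE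

variable {F : Type*}

lemma one [Semiring F] : TotalDegreeLE (1 : F[X][X]) 0 := by
  intro i j h
  rw [coeff_one]
  split_ifs with hi
  · rw [coeff_one, if_neg (by omega)]
  · simp

lemma mul [Semiring F] {P Q : F[X][X]} {a b : ℕ} (hP : TotalDegreeLE P a)
    (hQ : TotalDegreeLE Q b) : TotalDegreeLE (P * Q) (a + b) := by
  intro i j h
  rw [coeff_mul, finsetSum_coeff]
  refine sum_eq_zero fun x hx => ?_
  rw [coeff_mul]
  refine sum_eq_zero fun y hy => ?_
  rw [HasAntidiagonal.mem_antidiagonal] at hx hy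
  by_cases h1 : a < x.1 + y.1
  · rw [hP _ _ h1, zero_mul]
  · rw [hQ _ _ (by omega), mul_zero]

lemma X_sub_C_linear [Ring F] (a b : F) :
    TotalDegreeLE (X - C (C b - C a * X) : F[X][X]) 1 := by
  intro i j h
  rcases i with _ | _ | i
  · obtain ⟨j, rfl⟩ : ∃ k, j = k + 2 := ⟨j - 2, by omega⟩
    simp [coeff_C, coeff_X]
  · obtain ⟨j, rfl⟩ : ∃ k, j = k + 1 := ⟨j - 1, by omega⟩
    simp [coeff_X, coeff_one]
  · simp [coeff_X]

lemma prod [CommSemiring F] {ι : Type*} (s : Finset ι) (f : ι → F[X][X])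
    (hf : ∀ i ∈ s, TotalDegreeLE (f i) 1) : TotalDegreeLE (∏ i ∈ s, f i) #s := by
  classical
  induction s using Finset.induction_on with
  | empty => simpa using one
  | insert a s ha ih =>
    rw [prod_insert ha, card_insert_of_notMem ha, add_comm]
    exact (hf a (mem_insert_self a s)).mul
      (ih fun i hi => hf i (mem_insert_of_mem hi))

/-- Reducing `X ^ k` modulo a monic polynomial whose total degree equals its degree does not
increase the total degree. -/
lemma exists_dvd_X_pow_sub [CommRing F] {H : F[X][X]} {n : ℕ} (hn : 0 < n)
    (hH : TotalDegreeLE H n) (hlead : H.coeff n = 1) (k : ℕ) :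
    ∃ R : F[X][X], TotalDegreeLE R k ∧ (∀ i, n ≤ i → R.coeff i = 0) ∧ H ∣ X ^ k - R := by
  induction k with
  | zero =>
    refine ⟨1, one, fun i hi => ?_, by simp⟩
    rw [coeff_one, if_neg (by omega)]
  | succ k ih =>
    obtain ⟨R, hRw, hRd, hR⟩ := ih
    have hHd : ∀ i, n < i → H.coeff i = 0 := fun i hi => by
      ext j
      simpa using hH i j (by omega)
    refine ⟨X * R - C (R.coeff (n - 1)) * H, ?_, ?_, ?_⟩
    · intro i j h
      rw [coeff_sub, coeff_C_mul, coeff_sub]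
      have h1 : ((X * R).coeff i).coeff j = 0 := by
        rcases i with _ | i
        · simp
        · rw [coeff_X_mul]
          exact hRw _ _ (by omega)
      rw [h1, zero_sub, neg_eq_zero, coeff_mul]
      refine sum_eq_zero fun x hx => ?_
      rw [HasAntidiagonal.mem_antidiagonal] at hx
      by_cases h2 : k < n - 1 + x.1
      · rw [hRw _ _ h2, zero_mul]
      · rw [hH _ _ (by omega), mul_zero]
    · intro i hi
      obtain ⟨i, rfl⟩ : ∃ l, i = l + 1 := ⟨i - 1, by omega⟩
      rw [coeff_sub, coeff_C_mul, coeff_X_mul]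
      rcases hi.eq_or_lt with rfl | hi
      · simp [hlead]
      · rw [hRd i (by omega), hHd _ hi]
        simp
    · have : (X ^ (k + 1) - (X * R - C (R.coeff (n - 1)) * H) : F[X][X])
          = X * (X ^ k - R) + C (R.coeff (n - 1)) * H := by ring
      rw [this]
      exact (hR.mul_left _).add (dvd_mul_left _ _)

end TotalDegreeLE

variable {F : Type*} [Field F]

lemma prod_X_sub_C_dvd_X_pow_card_sub_X [Fintype F] {ι : Type*} {s : Finset ι} {f : ι → F}
    (hf : Set.InjOn f s) : ∏ i ∈ s, (X - C (f i)) ∣ (X ^ Fintype.card F - X : F[X]) := by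
  refine Finset.prod_dvd_of_coprime (fun i hi j hj hij => ?_) fun i _ => ?_
  · exact isCoprime_X_sub_C_of_isUnit_sub (sub_ne_zero_of_ne (hf.ne hi hj hij)).isUnit
  · rw [dvd_iff_isRoot]
    simp [FiniteField.pow_card]

/-- If the set `D` contains every finite direction determined by `U`, then specialising the
Rédei polynomial of `U` gives a divisor of a lacunary polynomial. -/
lemma exists_redei_dvd_lacunary [Fintype F] (U : Finset (F × F)) (hU : 2 ≤ #U) (D : Finset F)
    (hD : ∀ y ∉ D, Set.InjOn (fun u : F × F => u.2 - u.1 * y) U) (z : F) :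
    ∃ R : F[X], R.natDegree ≤ max #D 1 ∧
      ∏ u ∈ U, (X - C (u.2 - u.1 * z)) ∣ X ^ Fintype.card F - R := by
  classical
  set H : F[X][X] := ∏ u ∈ U, (X - C (C u.2 - C u.1 * X)) with hHdef
  have hHmonic : H.Monic := monic_prod_of_monic _ _ fun u _ => monic_X_sub_C _
  have hHdeg : H.natDegree = #U := by
    rw [hHdef, natDegree_prod_of_monic _ _ fun u _ => monic_X_sub_C _]
    simp only [natDegree_X_sub_C, sum_const, smul_eq_mul, mul_one]
  have hHmap (y : F) : H.map (evalRingHom y) = ∏ u ∈ U, (X - C (u.2 - u.1 * y)) := by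
    rw [hHdef, Polynomial.map_prod]
    simp
  obtain ⟨R, hRw, hRd, hR⟩ := TotalDegreeLE.exists_dvd_X_pow_sub (by omega : 0 < #U)
    (TotalDegreeLE.prod U _ fun u _ => TotalDegreeLE.X_sub_C_linear u.1 u.2)
    (by rw [← hHdeg]; exact hHmonic.coeff_natDegree) (Fintype.card F)
  have hRmap (y : F) :
      ∏ u ∈ U, (X - C (u.2 - u.1 * y)) ∣ X ^ Fintype.card F - R.map (evalRingHom y) := by
    rw [← hHmap]
    have h1 := Polynomial.map_dvd (evalRingHom y) hR
    rwa [Polynomial.map_sub, Polynomial.map_pow, map_X] at h1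
  have hRX (y : F) (hy : y ∉ D) : R.map (evalRingHom y) = X := by
    have h1 := dvd_sub (prod_X_sub_C_dvd_X_pow_card_sub_X (hD y hy)) (hRmap y)
    rw [sub_sub_sub_cancel_left] at h1
    refine sub_eq_zero.1 (eq_zero_of_dvd_of_degree_lt h1 ?_)
    rw [← hHmap, degree_eq_natDegree (hHmonic.map _).ne_zero, hHmonic.natDegree_map, hHdeg,
      degree_lt_iff_coeff_zero]
    intro i hi
    rw [coeff_sub, coeff_map, hRd i hi, coeff_X, if_neg (by omega)]
    simp
  refine ⟨R.map (evalRingHom z), ?_, hRmap z⟩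
  rw [natDegree_le_iff_coeff_eq_zero]
  intro i hi
  have hi' : #D < i ∧ 1 < i := max_lt_iff.1 hi
  suffices R.coeff i = 0 by rw [coeff_map, this, map_zero]
  by_contra hne
  have hdeg : (R.coeff i).natDegree + i ≤ Fintype.card F := by
    by_contra! hlt
    exact hne (leadingCoeff_eq_zero.1 (hRw i _ (by omega)))
  refine hne (eq_zero_of_natDegree_lt_card_of_eval_eq_zero' _ Dᶜ (fun y hy => ?_) ?_)
  · have h2 := congrArg (fun P => coeff P i) (hRX y (mem_compl.1 hy))
    simpa [coeff_X, show (1 : ℕ) ≠ i by omega] using h2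
  · have := card_compl D
    omega

/-- Over a perfect field, a nonconstant polynomial is a `p ^ e`-th power of a polynomial with
nonzero derivative. -/
lemma exists_eq_pow_derivative_ne_zero (p : ℕ) [Fact p.Prime] [CharP F p] [PerfectRing F p]
    (P : F[X]) (hP : P.natDegree ≠ 0) :
    ∃ (e : ℕ) (G : F[X]), P = G ^ p ^ e ∧ derivative G ≠ 0 := by
  induction hd : P.natDegree using Nat.strong_induction_on generalizing P with
  | _ d ih =>
    by_cases hP' : derivative P = 0
    · have hp := (Fact.out : p.Prime)
      have h1 := expand_contract p hP' hp.ne_zero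
      rw [polynomial_expand_eq] at h1
      set Q := (contract p P).map ((frobeniusEquiv F p).symm : F →+* F) with hQ
      have h2 : P.natDegree = p * Q.natDegree := by rw [← h1, natDegree_pow]
      have h3 : Q.natDegree ≠ 0 := fun h => hP (by rw [h2, h, mul_zero])
      have h4 : Q.natDegree < d := by
        have := hp.two_le
        nlinarith [Nat.pos_of_ne_zero h3]
      obtain ⟨e, G, hG, hG'⟩ := ih _ h4 Q h3 rfl
      exact ⟨e + 1, G, by rw [← h1, hG, ← pow_mul, pow_succ], hG'⟩
    · exact ⟨0, P, by simp, hP'⟩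

lemma X_sub_C_pow_dvd_of_dvd_pow {G : F[X]} (hG : G ≠ 0) {b : F} {m t k : ℕ}
    (h : (X - C b) ^ m ∣ G ^ t) (hk : t * k < m) : (X - C b) ^ (k + 1) ∣ G := by
  classical
  rw [← le_rootMultiplicity_iff (pow_ne_zero t hG), ← count_roots, roots_pow,
    Multiset.count_nsmul, count_roots] at h
  rw [← le_rootMultiplicity_iff hG]
  exact Nat.lt_of_mul_lt_mul_left (hk.trans_le h)

/-- A polynomial `X ^ p ^ (2 * r + 1) - R` with at least `m` roots of multiplicity at least `m`,
where `2 * p ^ r < m`, cannot be too lacunary. -/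
lemma sq_lt_two_mul_of_prod_pow_dvd (p r N : ℕ) [Fact p.Prime] [CharP F p] [PerfectRing F p]
    (A : Finset F) (hlow : 2 * p ^ r < #A) (R : F[X])
    (hRN : R.natDegree ≤ N) (hN : N < p ^ (2 * r + 1))
    (hdvd : (∏ b ∈ A, (X - C b)) ^ #A ∣ X ^ p ^ (2 * r + 1) - R) : #A ^ 2 < 2 * N := by
  have hp := (Fact.out : p.Prime)
  have hPdeg : (X ^ p ^ (2 * r + 1) - R : F[X]).natDegree = p ^ (2 * r + 1) := by
    rw [natDegree_sub_eq_left_of_natDegree_lt (by rw [natDegree_X_pow]; omega), natDegree_X_pow]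
  obtain ⟨e, G, hG, hG'⟩ := exists_eq_pow_derivative_ne_zero p (X ^ p ^ (2 * r + 1) - R)
    (by rw [hPdeg]; exact (pow_pos hp.pos _).ne')
  have hG0 : G ≠ 0 := fun h => hG' (by simp [h])
  have hGdeg : p ^ e * G.natDegree = p ^ (2 * r + 1) := by
    rw [← natDegree_pow, ← hG, hPdeg]
  have hpe : 0 < p ^ e := pow_pos hp.pos e
  have hroot (b : F) (hb : b ∈ A) : (X - C b) ^ #A ∣ G ^ p ^ e := by
    rw [← hG]
    exact (pow_dvd_pow_of_dvd (Finset.dvd_prod_of_mem (fun b => X - C b) hb) #A).trans hdvd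
  have hdvd_of (k : ℕ) (Q : F[X]) (hQ : ∀ b ∈ A, (X - C b) ^ k ∣ Q) (hQ0 : Q ≠ 0) :
      #A * k ≤ Q.natDegree := by
    have h1 : ∏ b ∈ A, (X - C b) ^ k ∣ Q := by
      refine Finset.prod_dvd_of_coprime (fun i _ j _ hij => ?_) hQ
      exact (isCoprime_X_sub_C_of_isUnit_sub (sub_ne_zero_of_ne hij).isUnit).pow
    have h2 := natDegree_le_of_dvd h1 hQ0
    rwa [natDegree_prod_of_monic _ _ fun b _ => (monic_X_sub_C b).pow k,
      Finset.sum_congr rfl fun b _ => by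
        rw [(monic_X_sub_C b).natDegree_pow, natDegree_X_sub_C, mul_one],
      Finset.sum_const, smul_eq_mul] at h2
  obtain ⟨s, -, hs⟩ := (Nat.dvd_prime_pow hp).1 (Dvd.intro_left _ hGdeg)
  have hes : e + s = 2 * r + 1 := by
    rw [hs, ← pow_add] at hGdeg
    exact Nat.pow_right_injective hp.two_le hGdeg
  have hsr : r < s := by
    by_contra! hle
    have h1 := hdvd_of 1 G (fun b hb => X_sub_C_pow_dvd_of_dvd_pow hG0 (hroot b hb)
      (by omega)) hG0
    have h2 := Nat.pow_le_pow_right hp.pos hle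
    omega
  have her : p ^ e ≤ p ^ r := Nat.pow_le_pow_right hp.pos (by omega)
  set h := G - X ^ p ^ s with hh
  have hhpow : h ^ p ^ e = -R := by
    rw [hh, sub_pow_char_pow, ← hG, ← pow_mul, ← pow_add, add_comm s e, hes]
    ring
  have hhdeg : p ^ e * h.natDegree ≤ N := by
    rw [← natDegree_pow, hhpow, natDegree_neg]
    exact hRN
  have hder : derivative h = derivative G := by
    rw [hh, derivative_sub, derivative_X_pow]
    simp [show s ≠ 0 by omega]
  have hlt : (derivative h).natDegree < h.natDegree := natDegree_derivative_lt fun h0 =>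
    hG' (by rw [← hder]; exact derivative_of_natDegree_zero h0)
  set k := (#A - 1) / p ^ e with hk
  have hk1 : p ^ e * k < #A := by
    have := Nat.mul_div_le (#A - 1) (p ^ e)
    rw [← hk] at this
    omega
  have hk2 : #A ≤ p ^ e * k + p ^ e := by
    have := Nat.lt_mul_div_succ (#A - 1) hpe
    rw [← hk, mul_add] at this
    omega
  have hroot' (b : F) (hb : b ∈ A) : (X - C b) ^ k ∣ derivative G := by
    have h1 := pow_sub_one_dvd_derivative_of_pow_dvd
      (X_sub_C_pow_dvd_of_dvd_pow hG0 (hroot b hb) hk1)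
    rwa [Nat.add_sub_cancel] at h1
  have hfin := hdvd_of k (derivative G) hroot' hG'
  rw [← hder] at hfin
  have h3 : p ^ e * (#A * k + 1) ≤ N := (Nat.mul_le_mul_left _ (by omega)).trans hhdeg
  have h4 : #A * #A ≤ #A * (p ^ e * k + p ^ e) := Nat.mul_le_mul_left _ hk2
  have h5 : #A * (2 * p ^ e) ≤ #A * #A := Nat.mul_le_mul_left _ (by omega)
  linarith

end RedeiPolynomial

theorem stmt6 (p : ℕ) (hp : p.Prime) (hodd : Odd p)
    (r : ℕ) (q : ℕ) (hq : q = p ^ (2 * r + 1))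
    (F : Type*) [Field F] [Fintype F] (hF : Fintype.card F = q)
    (A : Finset F) (hlow : 2 * p ^ r < A.card) (hup : (A.card : ℝ) < Real.sqrt q) :
    ((A.card : ℝ) ^ 2 / 2 : ℝ) <
      ({x : F | ∃ a ∈ A, ∃ b ∈ A, ∃ c ∈ A, ∃ e ∈ A, c ≠ e ∧ x = (a - b) / (c - e)}.ncard : ℝ) := by
  classical
  have : Fact p.Prime := ⟨hp⟩
  have : CharP F p := charP_of_card_eq_prime_pow (hF.trans hq)
  set D := {x : F | ∃ a ∈ A, ∃ b ∈ A, ∃ c ∈ A, ∃ e ∈ A, c ≠ e ∧ x = (a - b) / (c - e)} with hD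
  have hpr : 0 < p ^ r := pow_pos hp.pos r
  have hsq : A.card ^ 2 < p ^ (2 * r + 1) := by
    rw [Real.lt_sqrt (by positivity), hq] at hup
    exact_mod_cast hup
  suffices A.card ^ 2 < 2 * D.ncard by
    have : ((A.card ^ 2 : ℕ) : ℝ) < ((2 * D.ncard : ℕ) : ℝ) := by exact_mod_cast this
    push_cast at this
    linarith
  rcases le_or_gt (p ^ (2 * r + 1)) D.ncard with hbig | hsmall
  · omega
  have hpos : 1 ≤ D.toFinset.card := by
    obtain ⟨c, hc, e, he, hce⟩ := Finset.one_lt_card.1 (by omega : 1 < A.card)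
    exact Finset.card_pos.2 ⟨0, by
      rw [Set.mem_toFinset]
      exact ⟨c, hc, c, hc, c, hc, e, he, hce, by simp⟩⟩
  obtain ⟨R, hRdeg, hR⟩ := exists_redei_dvd_lacunary (A ×ˢ A)
    (by rw [Finset.card_product]; nlinarith) D.toFinset (fun y hy u hu v hv huv => by
      rw [Finset.mem_coe, Finset.mem_product] at hu hv
      rw [Set.mem_toFinset] at hy
      dsimp only at huv
      by_cases h1 : u.1 = v.1
      · rw [h1] at huv
        exact Prod.ext h1 (sub_left_injective huv)
      · refine absurd ⟨u.2, hu.2, v.2, hv.2, u.1, hu.1, v.1, hv.1, h1, ?_⟩ hy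
        rw [eq_div_iff (sub_ne_zero_of_ne h1)]
        linear_combination -huv) 0
  rw [max_eq_left hpos, ← Set.ncard_eq_toFinset_card'] at hRdeg
  refine sq_lt_two_mul_of_prod_pow_dvd p r D.ncard A hlow R hRdeg hsmall ?_
  rw [← hq, ← hF]
  simpa [Finset.prod_product] using hR
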